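/- arXiv:2109.07584 — 10 statements merged into one kernel-verified Lean document; each statement's English description precedes it below -/
import Mathlib

section
/- Let l ∈ 𝕃 be an arbitrary element of the integer kernel of 𝒜 and let τ be a proper face of Conv(𝒜) (i.e. τ ≠ Conv(𝒜)). Then the family of components {l_j : j ∉ τ} either consists only of zeros, or it contains both a strictly positive and a strictly negative integer. -/
/-- If an integer weighted sum of nonnegative reals vanishes and some nonzero weight sits at a
positive entry, then some positive weight sits at a positive entry. -/
theorem exists_pos_of_sum_mul_eq_zero {ι : Type*} [Fintype ι] {l : ι → ℤ} {d : ι → ℝ}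
    (hd : ∀ j, 0 ≤ d j) (hsum : ∑ j, (l j : ℝ) * d j = 0)
    {k : ι} (hdk : 0 < d k) (hlk : l k ≠ 0) : ∃ j, 0 < d j ∧ 0 < l j := by
  by_contra! hneg
  have hterm : ∀ j ∈ Finset.univ, (l j : ℝ) * d j ≤ 0 := by
    intro j _
    rcases (hd j).eq_or_lt with h0 | h0
    · simp [← h0]
    · exact mul_nonpos_of_nonpos_of_nonneg (by exact_mod_cast hneg j h0) h0.le
  have hzero := (Finset.sum_eq_zero_iff_of_nonpos hterm).1 hsum k (Finset.mem_univ k)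
  rcases mul_eq_zero.1 hzero with h0 | h0
  · exact hlk (by exact_mod_cast h0)
  · exact hdk.ne' h0

/-- A linear functional bounded by `M` on `s` is bounded by `M` on the convex hull of `s`. -/
theorem LinearMap.le_of_mem_convexHull {E : Type*} [AddCommGroup E] [Module ℝ E]
    (φ : E →ₗ[ℝ] ℝ) {s : Set E} {M : ℝ} (hs : ∀ x ∈ s, φ x ≤ M) {x : E}
    (hx : x ∈ convexHull ℝ s) : φ x ≤ M :=
  convexHull_min (t := {y | φ y ≤ M}) hs (convex_halfSpace_le φ.isLinear M) hx

/-- Lemma (face-kernel): for `l` in the integer kernel of `𝒜` and a proper face `τ` of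
`Conv(𝒜)`, the components `{l j : j ∉ τ}` are either all zero or contain both a strictly
positive and a strictly negative integer. -/
theorem face_kernel (n N : ℕ) (a : Fin N → Fin (n + 1) → ℤ) (ha : Function.Injective a)
    (h : (Fin (n + 1) → ℤ) →ₗ[ℤ] ℤ) (hh : ∀ j, h (a j) = 1)
    (l : Fin N → ℤ) (hl : ∑ j, l j • a j = 0)
    (φ : (Fin (n + 1) → ℝ) →ₗ[ℝ] ℝ)
    (τ : Set (Fin (n + 1) → ℝ))
    (hτ : τ = {p ∈ convexHull ℝ (Set.range (fun j i => (a j i : ℝ))) |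
      ∀ q ∈ convexHull ℝ (Set.range (fun j i => (a j i : ℝ))), φ q ≤ φ p})
    (hproper : τ ≠ convexHull ℝ (Set.range (fun j i => (a j i : ℝ))))
    (τidx : Set (Fin N)) (hτidx : τidx = {j | (fun i => (a j i : ℝ)) ∈ τ}) :
    (∀ j ∉ τidx, l j = 0) ∨
      ((∃ j ∉ τidx, 0 < l j) ∧ (∃ j ∉ τidx, l j < 0)) := by
  rw [or_iff_not_imp_left]
  intro hne
  push Not at hne
  obtain ⟨k, hk, hlk⟩ := hne
  set v : Fin N → Fin (n + 1) → ℝ := fun j i => (a j i : ℝ) with hv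
  obtain ⟨j₀, -, hj₀⟩ := Finset.exists_max_image Finset.univ (fun j => φ (v j))
    ⟨k, Finset.mem_univ k⟩
  have hle : ∀ j, φ (v j) ≤ φ (v j₀) := fun j => hj₀ j (Finset.mem_univ j)
  have hmem : ∀ j, v j ∈ convexHull ℝ (Set.range v) := fun j =>
    subset_convexHull ℝ _ (Set.mem_range_self j)
  have hidx : ∀ j, j ∉ τidx ↔ 0 < φ (v j₀) - φ (v j) := by
    intro j
    rw [sub_pos, ← not_le, not_iff_not, hτidx, hτ]
    refine ⟨fun hj => hj.2 _ (hmem j₀), fun hj => ⟨hmem j, fun q hq => ?_⟩⟩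
    exact (φ.le_of_mem_convexHull (by rintro _ ⟨i, rfl⟩; exact hle i) hq).trans hj
  have hl_sum : ∑ j, (l j : ℝ) = 0 := by
    have := congrArg h hl
    simp only [map_sum, map_smul, hh, smul_eq_mul, mul_one, map_zero] at this
    exact_mod_cast this
  have hv_sum : ∑ j, (l j : ℝ) • v j = 0 := by
    ext i
    have := congrFun hl i
    simp only [Finset.sum_apply, Pi.smul_apply, smul_eq_mul, Pi.zero_apply, hv] at this ⊢
    exact_mod_cast this
  have hφ_sum : ∑ j, (l j : ℝ) * φ (v j) = 0 := by
    simpa [map_sum] using congrArg φ hv_sum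
  have hsum : ∑ j, (l j : ℝ) * (φ (v j₀) - φ (v j)) = 0 := by
    simp only [mul_sub, Finset.sum_sub_distrib, ← Finset.sum_mul, hl_sum, hφ_sum, zero_mul,
      sub_zero]
  have hd : ∀ j, 0 ≤ φ (v j₀) - φ (v j) := fun j => sub_nonneg.2 (hle j)
  have hdk := (hidx k).1 hk
  constructor
  · obtain ⟨j, hj, hlj⟩ := exists_pos_of_sum_mul_eq_zero hd hsum hdk hlk
    exact ⟨j, (hidx j).2 hj, hlj⟩
  · obtain ⟨j, hj, hlj⟩ := exists_pos_of_sum_mul_eq_zero (l := -l) hd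
      (by simpa using hsum) hdk (by simpa using hlk)
    exact ⟨j, (hidx j).2 hj, by simpa using hlj⟩
end

section
/- Let ξ ∈ ℂ^N be a vector satisfying the binomial relations ∏_{j : l_j>0} ξ_j^{l_j} = ∏_{j : l_j<0} ξ_j^{−l_j} for every l ∈ 𝕃 (these are the principal symbols of the toric operators of the 𝒜-hypergeometric system). Then there exists a unique face τ of Conv(𝒜) (possibly the empty face, corresponding to ξ = 0) such that ξ_j ≠ 0 if and only if j ∈ τ. -/
/-- **Farkas' lemma** over a linearly ordered field: a functional that is nonpositive wherever
finitely many functionals are nonpositive is a nonnegative combination of them. -/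
theorem exists_nonneg_eq_sum_smul_of_forall_nonpos {K V ι : Type*} [Field K] [LinearOrder K]
    [IsStrictOrderedRing K] [AddCommGroup V] [Module K V] (s : Finset ι)
    (f : ι → V →ₗ[K] K) (g : V →ₗ[K] K)
    (hfg : ∀ x, (∀ i ∈ s, f i x ≤ 0) → g x ≤ 0) :
    ∃ c : ι → K, (∀ i, 0 ≤ c i) ∧ g = ∑ i ∈ s, c i • f i := by
  classical
  induction s using Finset.induction_on generalizing f g with
  | empty =>
    refine ⟨0, fun _ => le_rfl, LinearMap.ext fun x => ?_⟩
    have h₁ := hfg x (by simp)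
    have h₂ := hfg (-x) (by simp)
    simp only [map_neg] at h₂
    simp only [Finset.sum_empty, LinearMap.zero_apply]
    linarith
  | insert m s hm ih =>
    by_cases hs : ∀ x, (∀ i ∈ s, f i x ≤ 0) → g x ≤ 0
    · obtain ⟨c, hc, hg⟩ := ih f g hs
      refine ⟨Function.update c m 0, fun i => ?_, ?_⟩
      · by_cases hi : i = m
        · simp [hi]
        · simpa [hi] using hc i
      · rw [Finset.sum_insert hm, hg]
        simp only [Function.update_self, zero_smul, zero_add]
        refine Finset.sum_congr rfl fun i hi => ?_
        rw [Function.update_of_ne (ne_of_mem_of_not_mem hi hm)]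
    · push Not at hs
      obtain ⟨y, hy, hgy⟩ := hs
      have hmy : 0 < f m y := by
        by_contra! hle
        refine absurd (hfg y fun i hi => ?_) (not_le.2 hgy)
        rcases Finset.mem_insert.1 hi with rfl | hi
        exacts [hle, hy i hi]
      obtain ⟨z, hz, hgz, hmz⟩ : ∃ z, (∀ i ∈ s, f i z ≤ 0) ∧ 0 < g z ∧ f m z = 1 := by
        refine ⟨(f m y)⁻¹ • y, fun i hi => ?_, ?_, ?_⟩
        · simpa using mul_nonpos_of_nonneg_of_nonpos (inv_pos.2 hmy).le (hy i hi)
        · simpa using mul_pos (inv_pos.2 hmy) hgy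
        · simp [hmy.ne']
      obtain ⟨c, hc, hg⟩ := ih (fun i => f i - f i z • f m) (g - g z • f m) fun x hx => by
        have := hfg (x - f m x • z) fun i hi => by
          rcases Finset.mem_insert.1 hi with rfl | hi
          · simp [hmz]
          · simpa [mul_comm] using hx i hi
        simpa [mul_comm] using this
      have hd : 0 ≤ g z - ∑ i ∈ s, c i * f i z := by
        have := Finset.sum_nonpos fun i hi => mul_nonpos_of_nonneg_of_nonpos (hc i) (hz i hi)
        linarith
      refine ⟨Function.update c m (g z - ∑ i ∈ s, c i * f i z), fun i => ?_, ?_⟩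
      · by_cases hi : i = m
        · simpa [hi] using hd
        · simpa [hi] using hc i
      · have hcongr : ∑ i ∈ s, Function.update c m (g z - ∑ i ∈ s, c i * f i z) i • f i =
            ∑ i ∈ s, c i • f i := Finset.sum_congr rfl fun i hi => by
          rw [Function.update_of_ne (ne_of_mem_of_not_mem hi hm)]
        rw [Finset.sum_insert hm, hcongr, Function.update_self]
        ext w
        have hw := LinearMap.congr_fun hg w
        simp only [LinearMap.sub_apply, LinearMap.add_apply, LinearMap.smul_apply,
          LinearMap.sum_apply, smul_eq_mul, mul_sub, Finset.sum_sub_distrib, ← mul_assoc,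
          ← Finset.sum_mul] at hw ⊢
        linear_combination hw

/-- Finitely many rationals can be scaled to integers by a common positive factor. -/
theorem exists_pos_nat_mul_eq_intCast {ι : Type*} [Fintype ι] (c : ι → ℚ) :
    ∃ D : ℕ, 0 < D ∧ ∃ l : ι → ℤ, ∀ i, (l i : ℚ) = D * c i := by
  refine ⟨∏ i, (c i).den, Finset.prod_pos fun i _ => (c i).den_pos, ?_⟩
  have hex : ∀ i, ∃ z : ℤ, (z : ℚ) = (∏ i, (c i).den : ℕ) * c i := fun i => by
    obtain ⟨d, hd⟩ := Finset.dvd_prod_of_mem (fun i => (c i).den) (Finset.mem_univ i)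
    refine ⟨d * (c i).num, ?_⟩
    rw [hd]
    push_cast
    rw [mul_comm ((c i).den : ℚ), mul_assoc, mul_comm ((c i).den : ℚ), Rat.mul_den_eq_num]
  choose l hl using hex
  exact ⟨l, hl⟩

/-- If no integer relation among the `a j` has nonnegative coefficients off `S` and a positive one
at `k ∉ S`, then a rational functional vanishes on `S`, is nonpositive everywhere, and is negative
at `k`. -/
theorem exists_rat_dotProduct_neg {ι κ : Type*} [Fintype ι] [Fintype κ]
    (a : ι → κ → ℤ) (S : Set ι) (k : ι)
    (hrel : ∀ l : ι → ℤ, ∑ j, l j • a j = 0 → (∀ j ∉ S, 0 ≤ l j) → ¬ 0 < l k)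
    (hk : k ∉ S) :
    ∃ x : κ → ℚ, (∀ j ∈ S, (fun i => (a j i : ℚ)) ⬝ᵥ x = 0) ∧
      (∀ j, (fun i => (a j i : ℚ)) ⬝ᵥ x ≤ 0) ∧ (fun i => (a k i : ℚ)) ⬝ᵥ x < 0 := by
  classical
  by_contra! hno
  let f : ι → (κ → ℚ) →ₗ[ℚ] ℚ := fun j => dotProductBilin ℚ ℚ (fun i => (a j i : ℚ))
  have hf : ∀ j x, f j x = (fun i => (a j i : ℚ)) ⬝ᵥ x := fun _ _ => rfl
  obtain ⟨c, hc, hg⟩ := exists_nonneg_eq_sum_smul_of_forall_nonpos Finset.univ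
    (Sum.elim f fun j => if j ∈ S then -f j else 0) (-f k) fun x hx => by
      have hle : ∀ j, f j x ≤ 0 := fun j => hx (Sum.inl j) (Finset.mem_univ _)
      have := hno x (fun j hj => le_antisymm (hle j) ?_) hle
      · simpa [hf] using this
      · simpa [hj, hf] using hx (Sum.inr j) (Finset.mem_univ _)
  let e : ι → ℚ := fun j =>
    c (Sum.inl j) - (if j ∈ S then c (Sum.inr j) else 0) + if j = k then 1 else 0
  have he : ∑ j, e j • f j = 0 := by
    have hsum : ∑ j, e j • f j = (∑ j, c (Sum.inl j) • f j) +
        (∑ j, c (Sum.inr j) • if j ∈ S then -f j else 0) + f k := by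
      have hfk : f k = ∑ j, (if j = k then (1 : ℚ) else 0) • f j := by simp
      rw [hfk, ← Finset.sum_add_distrib, ← Finset.sum_add_distrib]
      refine Finset.sum_congr rfl fun j _ => ?_
      simp only [e]
      rw [add_smul, sub_smul]
      split_ifs <;> simp [sub_eq_add_neg]
    rw [Fintype.sum_sum_type] at hg
    simp only [Sum.elim_inl, Sum.elim_inr] at hg
    rw [hsum, ← hg, neg_add_cancel]
  obtain ⟨D, hD, l, hl⟩ := exists_pos_nat_mul_eq_intCast e
  have hD' : (0 : ℚ) < D := by exact_mod_cast hD
  refine hrel l ?_ (fun j hj => ?_) ?_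
  · ext i
    have hi := congrArg (fun φ => (D : ℚ) * φ (Pi.single i 1)) he
    simp only [LinearMap.sum_apply, LinearMap.smul_apply, hf, dotProduct_single_one, smul_eq_mul,
      LinearMap.zero_apply, mul_zero, Finset.mul_sum, ← mul_assoc, ← hl] at hi
    simp only [Finset.sum_apply, Pi.smul_apply, smul_eq_mul, Pi.zero_apply]
    exact_mod_cast hi
  · have : (0 : ℚ) ≤ l j := by
      rw [hl]
      refine mul_nonneg hD'.le ?_
      simp only [e, hj, if_false, sub_zero]
      exact add_nonneg (hc _) (by split_ifs <;> norm_num)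
    exact_mod_cast this
  · have : (0 : ℚ) < l k := by
      rw [hl]
      refine mul_pos hD' ?_
      simp only [e, hk, if_false, if_true, sub_zero]
      linarith [hc (Sum.inl k)]
    exact_mod_cast this

/-- If `ξ ∈ ℂ^N` satisfies the binomial relations coming from the toric operators of the
`𝒜`-hypergeometric system, then there is a unique face `τ` of `Conv(𝒜)` (possibly the empty
face) such that `ξ j ≠ 0` exactly for `j ∈ τ`. -/
theorem face_of_characteristic_point (n N : ℕ) (a : Fin N → Fin (n + 1) → ℤ)
    (ha : Function.Injective a)
    (h : (Fin (n + 1) → ℤ) →ₗ[ℤ] ℤ) (hh : ∀ j, h (a j) = 1)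
    (ξ : Fin N → ℂ)
    (hbin : ∀ l : Fin N → ℤ, ∑ j, l j • a j = 0 →
      ∏ j, ξ j ^ (l j).toNat = ∏ j, ξ j ^ (-l j).toNat) :
    ∃! τ : Set (Fin N),
      (τ = ∅ ∨ ∃ φ : (Fin (n + 1) → ℝ) →ₗ[ℝ] ℝ,
        τ = {j | ∀ q ∈ convexHull ℝ (Set.range (fun j' i => (a j' i : ℝ))),
          φ q ≤ φ (fun i => (a j i : ℝ))}) ∧
      ∀ j, ξ j ≠ 0 ↔ j ∈ τ := by
  classical
  refine ⟨{j | ξ j ≠ 0}, ⟨?_, fun j => Iff.rfl⟩, fun τ hτ => Set.ext fun j => (hτ.2 j).symm⟩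
  rw [or_iff_not_imp_left, ← ne_eq, ← Set.nonempty_iff_ne_empty]
  rintro ⟨j₀, hj₀⟩
  have hex : ∀ k, ∃ x : Fin (n + 1) → ℚ,
      (∀ j, ξ j ≠ 0 → (fun i => (a j i : ℚ)) ⬝ᵥ x = 0) ∧
      (∀ j, (fun i => (a j i : ℚ)) ⬝ᵥ x ≤ 0) ∧
      (ξ k = 0 → (fun i => (a k i : ℚ)) ⬝ᵥ x < 0) := fun k => by
    by_cases hk : ξ k = 0
    · obtain ⟨x, h₁, h₂, h₃⟩ := exists_rat_dotProduct_neg a {j | ξ j ≠ 0} k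
        (fun l hl hpos hlk => by
          have hzero : ∏ j, ξ j ^ (l j).toNat = 0 :=
            Finset.prod_eq_zero (Finset.mem_univ k) (by rw [hk]; exact zero_pow (by omega))
          rw [hbin l hl, Finset.prod_eq_zero_iff] at hzero
          obtain ⟨j, -, hj⟩ := hzero
          obtain ⟨hξ, hne⟩ := pow_eq_zero_iff'.1 hj
          have := hpos j (by simpa using hξ)
          omega) (by simpa using hk)
      exact ⟨x, h₁, h₂, fun _ => h₃⟩
    · exact ⟨0, by simp, by simp, fun h0 => absurd h0 hk⟩
  choose x hx₀ hx₁ hx₂ using hex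
  let φ : (Fin (n + 1) → ℝ) →ₗ[ℝ] ℝ := dotProductBilin ℝ ℝ fun i => ((∑ k, x k) i : ℝ)
  have hφ : ∀ j, φ (fun i => (a j i : ℝ)) =
      ((∑ k, (fun i => (a j i : ℚ)) ⬝ᵥ x k : ℚ) : ℝ) := fun j => by
    rw [← dotProduct_sum, dotProduct_comm]
    change ∑ i, ((∑ k, x k) i : ℝ) * (a j i : ℝ) = _
    simp [dotProduct]
  have hφ_zero : ∀ j, ξ j ≠ 0 → φ (fun i => (a j i : ℝ)) = 0 := fun j hj => by
    rw [hφ, Finset.sum_eq_zero fun k _ => hx₀ k j hj, Rat.cast_zero]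
  have hφ_neg : ∀ j, ξ j = 0 → φ (fun i => (a j i : ℝ)) < 0 := fun j hj => by
    rw [hφ, Rat.cast_lt_zero]
    exact Finset.sum_neg' (fun k _ => hx₁ k j) ⟨j, Finset.mem_univ j, hx₂ j hj⟩
  have hφ_hull : ∀ q ∈ convexHull ℝ (Set.range (fun j' i => (a j' i : ℝ))), φ q ≤ 0 := by
    refine convexHull_min ?_ (convex_halfSpace_le φ.isLinear 0)
    rintro _ ⟨j, rfl⟩
    by_cases hj : ξ j = 0
    exacts [(hφ_neg j hj).le, (hφ_zero j hj).le]
  refine ⟨φ, Set.ext fun j => ⟨fun hj q hq => (hφ_hull q hq).trans (hφ_zero j hj).ge,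
    fun hj hξ => ?_⟩⟩
  have hle := hj _ (subset_convexHull ℝ _ ⟨j₀, rfl⟩)
  rw [hφ_zero j₀ hj₀] at hle
  exact absurd (hφ_neg j hξ) (not_lt.2 hle)
end

section
/- Let τ be a nonempty face of Conv(𝒜), let ẑ ∈ ℂ^N, and suppose x̂ ∈ (ℂ*)^{n+1} is a common zero of all partial derivatives ∂f_{τ,ẑ}/∂x_0, …, ∂f_{τ,ẑ}/∂x_n of the truncated polynomial. Define ξ̂ ∈ ℂ^N by ξ̂_j = x̂^{a^{(j)}} for j ∈ τ and ξ̂_j = 0 for j ∉ τ. Then: (a) ∑_{j=1}^N a_i^{(j)} ẑ_j ξ̂_j = 0 for every coordinate i = 0,…,n (the principal symbols of the homogeneous Euler operators vanish at (ẑ,ξ̂)), and (b) ∏_{j : l_j>0} ξ̂_j^{l_j} = ∏_{j : l_j<0} ξ̂_j^{−l_j} for every l ∈ 𝕃 (the principal symbols of the toric operators vanish at ξ̂). -/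
/-- If a linear relation `l` annihilates nonnegative weights, and some weight is positive at an index
where `l` is positive, then some weight is positive at an index where `l` is negative. -/
lemma exists_neg_of_sum_mul_eq_zero {ι : Type*} [Fintype ι] {w : ι → ℝ} (hw : ∀ j, 0 ≤ w j)
    {l : ι → ℤ} (hl : ∑ j, (l j : ℝ) * w j = 0) {k : ι} (hk : 0 < w k) (hlk : 0 < l k) :
    ∃ j, 0 < w j ∧ l j < 0 := by
  by_contra! hc
  have hnonneg : ∀ j ∈ Finset.univ, 0 ≤ (l j : ℝ) * w j := by
    intro j _
    rcases (hw j).eq_or_lt with h0 | h0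
    · simp [← h0]
    · exact mul_nonneg (by exact_mod_cast hc j h0) h0.le
  have h0 := (Finset.sum_eq_zero_iff_of_nonneg hnonneg).1 hl k (Finset.mem_univ k)
  have hpos : (0 : ℝ) < l k * w k := mul_pos (by exact_mod_cast hlk) hk
  exact hpos.ne' h0

/-- A Laurent monomial map satisfies the binomial relations given by its exponent vectors. -/
lemma prod_zpow_eq_one_of_relation {ι κ K : Type*} [Fintype ι] [Fintype κ] [Field K]
    {a : ι → κ → ℤ} {x : κ → K} (hx : ∀ i, x i ≠ 0) {l : ι → ℤ} (hl : ∑ j, l j • a j = 0) :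
    ∏ j, (∏ i, x i ^ a j i) ^ l j = 1 := by
  have hcoord (i : κ) : ∑ j, a j i * l j = 0 := by
    simpa [mul_comm] using congrFun hl i
  simp_rw [← Finset.prod_zpow, ← zpow_mul]
  rw [Finset.prod_comm]
  refine Finset.prod_eq_one fun i _ => ?_
  have hsum (s : Finset ι) : ∏ j ∈ s, x i ^ (a j i * l j) = x i ^ ∑ j ∈ s, a j i * l j := by
    classical
    induction s using Finset.induction_on with
    | empty => simp
    | insert j s hj ih => rw [Finset.prod_insert hj, Finset.sum_insert hj, zpow_add₀ (hx i), ih]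
  rw [hsum, hcoord, zpow_zero]

lemma pow_toNat_eq_pow_toNat_neg_mul_zpow {K : Type*} [Field K] {t : K} (ht : t ≠ 0) (m : ℤ) :
    t ^ m.toNat = t ^ (-m).toNat * t ^ m := by
  rw [← zpow_natCast, ← zpow_natCast, ← zpow_add₀ ht]
  congr 1
  omega

/-- If `x̂` is a point of the torus at which all partial derivatives of the truncated
polynomial `f_{τ,ẑ}` vanish, and `ξ̂` is defined by `ξ̂ j = x̂ ^ a⁽ʲ⁾` for `j ∈ τ` and `0`
otherwise, then the principal symbols of the Euler operators and of the toric operators of the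
`𝒜`-hypergeometric system all vanish at `(ẑ, ξ̂)`. -/
theorem characteristic_point_of_critical_point (n N : ℕ) (a : Fin N → Fin (n + 1) → ℤ)
    (ha : Function.Injective a)
    (h : (Fin (n + 1) → ℤ) →ₗ[ℤ] ℤ) (hh : ∀ j, h (a j) = 1)
    (φ : (Fin (n + 1) → ℝ) →ₗ[ℝ] ℝ)
    (τ : Finset (Fin N))
    (hτ : ∀ j : Fin N, j ∈ τ ↔
      ∀ q ∈ convexHull ℝ (Set.range (fun j' i => (a j' i : ℝ))),
        φ q ≤ φ (fun i => (a j i : ℝ)))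
    (hτne : τ.Nonempty)
    (z : Fin N → ℂ) (x : Fin (n + 1) → ℂ) (hx : ∀ i, x i ≠ 0)
    (hcrit : ∀ i : Fin (n + 1),
      ∑ j ∈ τ, z j * (a j i : ℂ) * ∏ i', x i' ^ (a j i' - if i' = i then 1 else 0) = 0)
    (ξ : Fin N → ℂ)
    (hξ : ξ = fun j => if j ∈ τ then ∏ i, x i ^ (a j i) else 0) :
    (∀ i : Fin (n + 1), ∑ j, (a j i : ℂ) * z j * ξ j = 0) ∧
    (∀ l : Fin N → ℤ, ∑ j, l j • a j = 0 →
      ∏ j, ξ j ^ (l j).toNat = ∏ j, ξ j ^ (-l j).toNat) := by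
  classical
  subst hξ
  refine ⟨fun i => ?_, fun l hl => ?_⟩
  · have hi := congrArg (x i * ·) (hcrit i)
    simp only [mul_zero, Finset.mul_sum] at hi
    simp only [mul_ite, mul_zero, Finset.sum_ite_mem, Finset.univ_inter]
    rw [← hi]
    refine Finset.sum_congr rfl fun j _ => ?_
    have hshift : ∏ i', x i' ^ (a j i' - if i' = i then 1 else 0)
        = (∏ i', x i' ^ a j i') * (x i)⁻¹ := by
      have hfac (i' : Fin (n + 1)) : x i' ^ (a j i' - if i' = i then 1 else 0)
          = x i' ^ a j i' * (if i' = i then (x i')⁻¹ else 1) := by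
        split_ifs
        · rw [zpow_sub_one₀ (hx i')]
        · simp
      rw [Finset.prod_congr rfl fun i' _ => hfac i', Finset.prod_mul_distrib]
      simp
    rw [hshift]
    have hxi := hx i
    field_simp
  · let v : Fin N → Fin (n + 1) → ℝ := fun j i => (a j i : ℝ)
    obtain ⟨j₀, hj₀⟩ := hτne
    have hv (j : Fin N) : v j ∈ convexHull ℝ (Set.range v) :=
      subset_convexHull ℝ _ ⟨j, rfl⟩
    have hmax : ∀ q ∈ convexHull ℝ (Set.range v), φ q ≤ φ (v j₀) := (hτ j₀).1 hj₀
    let w : Fin N → ℝ := fun j => φ (v j₀) - φ (v j)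
    have hw (j : Fin N) : 0 ≤ w j := sub_nonneg.2 (hmax _ (hv j))
    have hwτ (j : Fin N) : 0 < w j ↔ j ∉ τ := by
      refine ⟨fun hj hjτ => ?_, fun hj => ?_⟩
      · exact (sub_pos.1 hj).not_ge ((hτ j).1 hjτ _ (hv j₀))
      · rw [hτ j] at hj
        push Not at hj
        obtain ⟨q, hq, hlt⟩ := hj
        exact sub_pos.2 (hlt.trans_le (hmax q hq))
    have hsum : ∑ j, l j = 0 := by
      have hhl := congrArg h hl
      simpa only [map_sum, map_smul, hh, smul_eq_mul, mul_one, map_zero] using hhl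
    have hlv : ∑ j, (l j : ℝ) • v j = 0 := by
      ext i
      have hi := congrFun hl i
      simp only [Finset.sum_apply, Pi.smul_apply, smul_eq_mul, Pi.zero_apply] at hi
      simp only [v, Finset.sum_apply, Pi.smul_apply, smul_eq_mul, Pi.zero_apply]
      exact_mod_cast hi
    have hlw : ∑ j, (l j : ℝ) * w j = 0 := by
      have hφ := congrArg φ hlv
      simp only [map_sum, map_smul, smul_eq_mul, map_zero] at hφ
      have hsum' : ∑ j, (l j : ℝ) = 0 := by exact_mod_cast hsum
      simp only [w, mul_sub, Finset.sum_sub_distrib, ← Finset.sum_mul, hφ, hsum']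
      simp
    have hvanish {m : Fin N → ℤ} {k : Fin N} (hk : 0 < w k) (hm : 0 < m k) :
        ∏ j, (if j ∈ τ then ∏ i, x i ^ a j i else 0) ^ (m j).toNat = 0 := by
      refine Finset.prod_eq_zero (Finset.mem_univ k) ?_
      rw [if_neg ((hwτ k).1 hk), zero_pow (by omega)]
    by_cases hout : ∃ k, 0 < w k ∧ l k ≠ 0
    · obtain ⟨k, hk, hlk⟩ := hout
      obtain ⟨⟨p, hp, hlp⟩, ⟨q, hq, hlq⟩⟩ :
          (∃ p, 0 < w p ∧ 0 < l p) ∧ ∃ q, 0 < w q ∧ 0 < -l q := by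
        rcases hlk.lt_or_gt with hneg | hpos
        · obtain ⟨p, hp, hlp⟩ := exists_neg_of_sum_mul_eq_zero (l := fun j => -l j) hw
            (by simpa using hlw) hk (by omega)
          exact ⟨⟨p, hp, by omega⟩, k, hk, by omega⟩
        · obtain ⟨q, hq, hlq⟩ := exists_neg_of_sum_mul_eq_zero hw hlw hk hpos
          exact ⟨⟨k, hk, hpos⟩, q, hq, by omega⟩
      rw [hvanish hp hlp, hvanish (m := fun j => -l j) hq hlq]
    · have hstrip (m : Fin N → ℤ) (hm : ∀ j, l j = 0 → m j = 0) :
          ∏ j, (if j ∈ τ then ∏ i, x i ^ a j i else 0) ^ (m j).toNat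
            = ∏ j, (∏ i, x i ^ a j i) ^ (m j).toNat := by
        refine Finset.prod_congr rfl fun j _ => ?_
        by_cases hj : j ∈ τ
        · rw [if_pos hj]
        · have hlj : l j = 0 := by
            by_contra hne
            exact hout ⟨j, (hwτ j).2 hj, hne⟩
          simp [hm j hlj]
      have ht (j : Fin N) : ∏ i, x i ^ a j i ≠ 0 :=
        Finset.prod_ne_zero_iff.2 fun i _ => zpow_ne_zero _ (hx i)
      rw [hstrip l fun _ => id, hstrip (fun j => -l j) fun j hj => by simp [hj]]
      simp_rw [fun j => pow_toNat_eq_pow_toNat_neg_mul_zpow (ht j) (l j)]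
      rw [Finset.prod_mul_distrib, prod_zpow_eq_one_of_relation hx hl, mul_one]
end

section
/- Let τ be a nonempty face of Conv(𝒜), let ξ̂ ∈ ℂ^N be a vector with ξ̂_j ≠ 0 exactly for j ∈ τ that satisfies ∏_{j : l_j>0} ξ̂_j^{l_j} = ∏_{j : l_j<0} ξ̂_j^{−l_j} for every l ∈ 𝕃, and let ẑ ∈ ℂ^N satisfy the vector equation ∑_{j=1}^N a^{(j)} ẑ_j ξ̂_j = 0 in ℂ^{n+1}. Then the partial derivatives ∂f_{τ,ẑ}/∂x_0, …, ∂f_{τ,ẑ}/∂x_n of the truncated polynomial have a common zero x̂ ∈ (ℂ*)^{n+1}. -/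
/-- A homomorphism into a divisible group extends along any homomorphism with smaller kernel. -/
theorem AddMonoidHom.exists_comp_eq_of_ker_le {A B Q : Type*} [AddCommGroup A] [AddCommGroup B]
    [AddCommGroup Q] [DivisibleBy Q ℤ] (f : A →+ B) (g : A →+ Q) (hfg : f.ker ≤ g.ker) :
    ∃ k : B →+ Q, k.comp f = g := by
  obtain ⟨k, hk⟩ := (Module.Baer.of_divisible Q).extension_property_addMonoidHom
    (QuotientAddGroup.kerLift f) (QuotientAddGroup.kerLift_injective f)
    (QuotientAddGroup.lift f.ker g hfg)
  refine ⟨k, ?_⟩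
  ext x
  exact DFunLike.congr_fun hk (x : A ⧸ f.ker)

theorem Complex.exists_units_zpow_eq {m : ℤ} (hm : m ≠ 0) (u : ℂˣ) : ∃ v : ℂˣ, v ^ m = u := by
  refine ⟨Units.mk0 (Complex.exp (Complex.log u / m)) (Complex.exp_ne_zero _), Units.ext ?_⟩
  have hm' : (m : ℂ) ≠ 0 := by exact_mod_cast hm
  rw [Units.val_zpow_eq_zpow_val, Units.val_mk0, ← Complex.exp_int_mul, mul_div_cancel₀ _ hm',
    Complex.exp_log u.ne_zero]

/-- A system of monomial equations in a complex torus is solvable as soon as the right-hand sides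
satisfy every multiplicative relation forced by the exponents. -/
theorem Complex.exists_units_prod_zpow_eq {ι κ : Type*} [Fintype ι] [Fintype κ]
    (b : ι → κ → ℤ) (u : ι → ℂˣ)
    (hu : ∀ l : ι → ℤ, ∑ j, l j • b j = 0 → ∏ j, u j ^ l j = 1) :
    ∃ x : κ → ℂˣ, ∀ j, ∏ i, x i ^ b j i = u j := by
  classical
  let _ : DivisibleBy (Additive ℂˣ) ℤ :=
    divisibleByOfSMulRightSurj _ _ fun {m} hm y ↦
      (Complex.exists_units_zpow_eq hm y.toMul).imp fun v hv ↦ congrArg Additive.ofMul hv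
  let f : (ι → ℤ) →+ (κ → ℤ) := (Fintype.linearCombination ℤ b).toAddMonoidHom
  let g : (ι → ℤ) →+ Additive ℂˣ :=
    (Fintype.linearCombination ℤ fun j ↦ Additive.ofMul (u j)).toAddMonoidHom
  have hf (l : ι → ℤ) : f l = ∑ j, l j • b j := rfl
  have hg (l : ι → ℤ) : g l = Additive.ofMul (∏ j, u j ^ l j) := by
    simp [g, Fintype.linearCombination_apply, ofMul_prod]
  obtain ⟨k, hk⟩ := AddMonoidHom.exists_comp_eq_of_ker_le f g fun l hl ↦ by
    rw [AddMonoidHom.mem_ker, hg, hu l hl, ofMul_one]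
  refine ⟨fun i ↦ (k (Pi.single i 1)).toMul, fun j ↦ Additive.ofMul.injective ?_⟩
  have h₁ : k (b j) = Additive.ofMul (u j) := by
    have := DFunLike.congr_fun hk (Pi.single j 1)
    rw [AddMonoidHom.comp_apply, hf, hg] at this
    simpa [Pi.single_apply] using this
  rw [← h₁, ofMul_prod]
  conv_rhs => rw [pi_eq_sum_univ' (b j), map_sum]
  refine Finset.sum_congr rfl fun i _ ↦ ?_
  rw [map_zsmul]
  simp only [ofMul_zpow, ofMul_toMul]

/-- If `ξ̂` is supported exactly on a nonempty face `τ`, satisfies the binomial relations of the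
toric operators, and `ẑ` satisfies the vector equation `∑ j, a⁽ʲ⁾ ẑ j ξ̂ j = 0`, then the
partial derivatives of the truncated polynomial `f_{τ,ẑ}` have a common zero in the torus. -/
theorem critical_point_of_characteristic_point (n N : ℕ) (a : Fin N → Fin (n + 1) → ℤ)
    (ha : Function.Injective a)
    (h : (Fin (n + 1) → ℤ) →ₗ[ℤ] ℤ) (hh : ∀ j, h (a j) = 1)
    (φ : (Fin (n + 1) → ℝ) →ₗ[ℝ] ℝ)
    (τ : Finset (Fin N))
    (hτ : ∀ j : Fin N, j ∈ τ ↔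
      ∀ q ∈ convexHull ℝ (Set.range (fun j' i => (a j' i : ℝ))),
        φ q ≤ φ (fun i => (a j i : ℝ)))
    (hτne : τ.Nonempty)
    (ξ : Fin N → ℂ) (hξsupp : ∀ j, ξ j ≠ 0 ↔ j ∈ τ)
    (hbin : ∀ l : Fin N → ℤ, ∑ j, l j • a j = 0 →
      ∏ j, ξ j ^ (l j).toNat = ∏ j, ξ j ^ (-l j).toNat)
    (z : Fin N → ℂ) (hz : ∀ i : Fin (n + 1), ∑ j, (a j i : ℂ) * z j * ξ j = 0) :
    ∃ x : Fin (n + 1) → ℂ, (∀ i, x i ≠ 0) ∧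
      ∀ i : Fin (n + 1),
        ∑ j ∈ τ, z j * (a j i : ℂ) * ∏ i', x i' ^ (a j i' - if i' = i then 1 else 0) = 0 := by
  have h_units : ∃ x : Fin (n + 1) → ℂˣ, ∀ j : τ,
      ∏ i, x i ^ a j i = Units.mk0 (ξ j) ((hξsupp j).2 j.2) := by
    refine Complex.exists_units_prod_zpow_eq (fun j : τ ↦ a j) _ fun l hl ↦ ?_
    let l' : Fin N → ℤ := fun j ↦ if hj : j ∈ τ then l ⟨j, hj⟩ else 0
    have hl' (j : τ) : l' j = l j := dif_pos j.2
    have h_off {j : Fin N} (hj : j ∉ τ) : l' j = 0 := dif_neg hj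
    have h_rel : ∑ j, l' j • a j = 0 := by
      rw [← hl, ← Finset.sum_subset τ.subset_univ fun j _ hj ↦ by rw [h_off hj, zero_smul],
        ← Finset.sum_coe_sort τ]
      exact Finset.sum_congr rfl fun j _ ↦ by rw [hl']
    have h_prod := hbin l' h_rel
    rw [← Finset.prod_subset τ.subset_univ fun j _ hj ↦ by simp [h_off hj],
      ← Finset.prod_subset τ.subset_univ fun j _ hj ↦ by simp [h_off hj],
      ← Finset.prod_coe_sort τ, ← Finset.prod_coe_sort τ] at h_prod
    simp only [hl'] at h_prod
    have h_split (j : τ) : ξ j ^ l j = ξ j ^ (l j).toNat / ξ j ^ (-l j).toNat := by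
      rw [← zpow_natCast, ← zpow_natCast, ← zpow_sub₀ ((hξsupp j).2 j.2), Int.toNat_sub_toNat_neg]
    refine Units.ext ?_
    simp only [Units.coe_prod, Units.val_zpow_eq_zpow_val, Units.val_mk0, Units.val_one, h_split,
      Finset.prod_div_distrib, h_prod]
    exact div_self (Finset.prod_ne_zero_iff.2 fun j _ ↦ pow_ne_zero _ ((hξsupp j).2 j.2))
  obtain ⟨x, hx⟩ := h_units
  have hx' (j : Fin N) (hj : j ∈ τ) : ∏ i, (x i : ℂ) ^ a j i = ξ j := by
    simpa using congrArg Units.val (hx ⟨j, hj⟩)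
  refine ⟨fun i ↦ x i, fun i ↦ (x i).ne_zero, fun i ↦ ?_⟩
  have h_term (j : Fin N) (hj : j ∈ τ) :
      z j * (a j i : ℂ) * ∏ i', (x i' : ℂ) ^ (a j i' - if i' = i then 1 else 0) =
        (a j i : ℂ) * z j * ξ j / x i := by
    simp only [zpow_sub₀ (Units.ne_zero _), Finset.prod_div_distrib, hx' j hj, pow_ite, zpow_one,
      zpow_zero, Finset.prod_ite_eq', Finset.mem_univ, if_true]
    ring
  rw [Finset.sum_congr rfl h_term, ← Finset.sum_div,
    Finset.sum_subset τ.subset_univ fun j _ hj ↦ by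
      rw [not_not.1 (mt (hξsupp j).1 hj), mul_zero],
    hz i, zero_div]
end

section
/- With the notation of the context, the scalar Λ satisfies Λ(k,p,x) = tr(kᵀMk) + 2·tr(pᵀBk) + tr(pᵀCp) + J. Moreover, if det M ≠ 0, then for k* = −M^{-1}Bᵀp one has det(M)·Λ(k*,p,x) = ℱ(x); equivalently Λ(k*,p,x) = ℱ(x)/𝒰(x), i.e. the second Symanzik polynomial divided by the first is the value of Λ at the critical point of Λ in k. -/
namespace Matrix

variable {l m n o α : Type*} [Fintype l] [Fintype m] [Fintype n] [Fintype o] [CommRing α]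

theorem trace_transpose_mul_diagonal_mul_self [DecidableEq m] (Q : Matrix m n α) (x : m → α) :
    (Qᵀ * diagonal x * Q).trace = ∑ i, x i * ∑ j, Q i j ^ 2 := by
  simp only [trace, diag_apply, mul_apply (M := Qᵀ * diagonal x), mul_diagonal, transpose_apply,
    Finset.mul_sum]
  rw [Finset.sum_comm]
  exact Finset.sum_congr rfl fun i _ => Finset.sum_congr rfl fun j _ => by ring

/-- Expansion of a quadratic form with symmetric kernel `D` at `R * k + S * p`. -/
theorem trace_quadratic_mul_add_mul {D : Matrix m m α} (hD : D.IsSymm)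
    (R : Matrix m n α) (S : Matrix m l α) (k : Matrix n o α) (p : Matrix l o α) :
    ((R * k + S * p)ᵀ * D * (R * k + S * p)).trace =
      (kᵀ * (Rᵀ * D * R) * k).trace + 2 * (pᵀ * (Sᵀ * D * R) * k).trace +
        (pᵀ * (Sᵀ * D * S) * p).trace := by
  have cross : (kᵀ * (Rᵀ * D * S) * p).trace = (pᵀ * (Sᵀ * D * R) * k).trace := by
    rw [← trace_transpose]
    simp only [transpose_mul, transpose_transpose, hD.eq, Matrix.mul_assoc]
  have expand : (R * k + S * p)ᵀ * D * (R * k + S * p) =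
      kᵀ * (Rᵀ * D * R) * k + kᵀ * (Rᵀ * D * S) * p +
        (pᵀ * (Sᵀ * D * R) * k + pᵀ * (Sᵀ * D * S) * p) := by
    simp only [transpose_add, transpose_mul, Matrix.add_mul, Matrix.mul_add, Matrix.mul_assoc]
    abel
  rw [expand, trace_add, trace_add, trace_add, cross]
  ring

/-- Completing the square: the value of `tr (kᵀ M k) + 2 tr (pᵀ B k)` at its critical point. -/
theorem trace_quadratic_add_linear_at_critical [DecidableEq n] {M : Matrix n n α} (hM : M.IsSymm)
    (hdet : IsUnit M.det) (B : Matrix l n α) (p : Matrix l o α) :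
    ((-(M⁻¹ * Bᵀ * p))ᵀ * M * -(M⁻¹ * Bᵀ * p)).trace +
        2 * (pᵀ * B * -(M⁻¹ * Bᵀ * p)).trace =
      -(pᵀ * B * M⁻¹ * Bᵀ * p).trace := by
  have quadratic : (-(M⁻¹ * Bᵀ * p))ᵀ * M * -(M⁻¹ * Bᵀ * p) = pᵀ * B * M⁻¹ * Bᵀ * p := by
    simp only [transpose_neg, transpose_mul, transpose_transpose, transpose_nonsing_inv, hM.eq,
      Matrix.neg_mul, Matrix.mul_neg, neg_neg, Matrix.mul_assoc,
      mul_nonsing_inv_cancel_left _ _ hdet]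
  have linear : pᵀ * B * -(M⁻¹ * Bᵀ * p) = -(pᵀ * B * M⁻¹ * Bᵀ * p) := by
    simp only [Matrix.mul_neg, Matrix.mul_assoc]
  rw [quadratic, linear, trace_neg]
  ring

theorem det_mul_trace_mul_nonsing_inv_mul [DecidableEq n] {M : Matrix n n α}
    (hdet : IsUnit M.det) (P : Matrix o n α) (Q : Matrix n o α) :
    M.det * (P * M⁻¹ * Q).trace = (P * M.adjugate * Q).trace := by
  rw [← smul_eq_mul, ← trace_smul, ← Matrix.smul_mul, ← Matrix.mul_smul, inv_def, smul_smul,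
    Ring.mul_inverse_cancel _ hdet, one_smul]

end Matrix


open Matrix in
/-- The scalar `Λ` decomposes as `tr(kᵀMk) + 2 tr(pᵀBk) + tr(pᵀCp) + J`, and if `det M ≠ 0`
then at the critical point `k* = -M⁻¹Bᵀp` one has `det M · Λ(k*) = ℱ`, i.e.
`Λ(k*) = ℱ/𝒰`: the second Symanzik polynomial over the first. -/
theorem lambda_decomposition_and_critical_value (n L E d : ℕ)
    (hn : 0 < n) (hL : 0 < L) (hE : 0 < E) (hd : 0 < d)
    (R : Matrix (Fin n) (Fin L) ℂ) (S : Matrix (Fin n) (Fin E) ℂ)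
    (m x : Fin n → ℂ) (p : Matrix (Fin E) (Fin d) ℂ)
    (M : Matrix (Fin L) (Fin L) ℂ) (hM : M = Rᵀ * Matrix.diagonal x * R)
    (B : Matrix (Fin E) (Fin L) ℂ) (hB : B = Sᵀ * Matrix.diagonal x * R)
    (C : Matrix (Fin E) (Fin E) ℂ) (hC : C = Sᵀ * Matrix.diagonal x * S)
    (J : ℂ) (hJ : J = ∑ i, x i * m i ^ 2)
    (Lam : Matrix (Fin L) (Fin d) ℂ → ℂ)
    (hLam : Lam = fun k => ∑ i, x i * ((∑ α, ((R * k + S * p) i α) ^ 2) + m i ^ 2))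
    (F : ℂ)
    (hF : F = -(pᵀ * B * M.adjugate * Bᵀ * p).trace + M.det * ((pᵀ * C * p).trace + J)) :
    (∀ k, Lam k = (kᵀ * M * k).trace + 2 * (pᵀ * B * k).trace + (pᵀ * C * p).trace + J) ∧
    (M.det ≠ 0 →
      M.det * Lam (-(M⁻¹ * Bᵀ * p)) = F ∧ Lam (-(M⁻¹ * Bᵀ * p)) = F / M.det) := by
  have decomposition : ∀ k, Lam k =
      (kᵀ * M * k).trace + 2 * (pᵀ * B * k).trace + (pᵀ * C * p).trace + J := by
    intro k
    subst hM hB hC hJ hLam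
    rw [← trace_quadratic_mul_add_mul (isSymm_diagonal x), trace_transpose_mul_diagonal_mul_self,
      ← Finset.sum_add_distrib]
    simp only [mul_add]
  refine ⟨decomposition, fun hdet => ?_⟩
  have hsymm : M.IsSymm := by
    rw [hM, IsSymm]
    simp only [transpose_mul, transpose_transpose, diagonal_transpose, Matrix.mul_assoc]
  have hunit : IsUnit M.det := hdet.isUnit
  have critical : M.det * Lam (-(M⁻¹ * Bᵀ * p)) = F := by
    have hadj := det_mul_trace_mul_nonsing_inv_mul hunit (pᵀ * B) (Bᵀ * p)
    simp only [← Matrix.mul_assoc] at hadj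
    rw [decomposition, trace_quadratic_add_linear_at_critical hsymm hunit, hF, ← hadj]
    ring
  exact ⟨critical, eq_div_of_mul_eq hdet (by rw [mul_comm, critical])⟩
end

section
/- (Parametric space Landau equations.) Fix x ∈ ℂ^n with 𝒰(x) = det M(x) ≠ 0, and regard ℱ as a polynomial function of x with p and m fixed. Then the following are equivalent: (i) there exists k ∈ ℂ^{L×d} such that Mk + Bᵀp = 0 (i.e. ∂Λ/∂k = 0) and x_i·D_i(k) = 0 for all i = 1,…,n; (ii) ℱ(x) = 0 and x_i·(∂ℱ/∂x_i)(x) = 0 for all i = 1,…,n. In other words, under the assumption 𝒰 ≠ 0, the momentum-space Landau equations have a solution at x if and only if the parametric-space Landau equations hold at x. -/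
theorem Matrix.differentiableAt_det {V ι : Type*} [NormedAddCommGroup V] [NormedSpace ℂ V]
    [Fintype ι] [DecidableEq ι] {A : V → Matrix ι ι ℂ} {x : V}
    (hA : ∀ i j, DifferentiableAt ℂ (fun y => A y i j) x) :
    DifferentiableAt ℂ (fun y => (A y).det) x := by
  simp only [Matrix.det_apply]
  refine DifferentiableAt.fun_sum fun σ _ => DifferentiableAt.const_smul ?_ _
  exact (HasFDerivAt.finsetProd fun i _ => (hA (σ i) i).hasFDerivAt).differentiableAt

theorem Matrix.differentiableAt_adjugate_apply {V ι : Type*} [NormedAddCommGroup V]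
    [NormedSpace ℂ V] [Fintype ι] [DecidableEq ι] {A : V → Matrix ι ι ℂ} {x : V}
    (hA : ∀ i j, DifferentiableAt ℂ (fun y => A y i j) x) (i j : ι) :
    DifferentiableAt ℂ (fun y => (A y).adjugate i j) x := by
  simp only [Matrix.adjugate_apply]
  refine Matrix.differentiableAt_det fun a b => ?_
  by_cases h : a = j
  · subst h
    simp
  · simpa [Matrix.updateRow_ne h] using hA a b

/-- A quadratic form in functions vanishing at `x` is stationary at `x`. -/
theorem Matrix.hasFDerivAt_trace_transpose_mul_mul_of_eq_zero {V ι κ : Type*}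
    [NormedAddCommGroup V] [NormedSpace ℂ V] [Fintype ι] [Fintype κ]
    {v : V → Matrix ι κ ℂ} {A : V → Matrix ι ι ℂ} {x : V}
    (hv : ∀ i j, DifferentiableAt ℂ (fun y => v y i j) x)
    (hA : ∀ i j, DifferentiableAt ℂ (fun y => A y i j) x) (hx : v x = 0) :
    HasFDerivAt (fun y => ((v y).transpose * A y * v y).trace) (0 : V →L[ℂ] ℂ) x := by
  simp only [Matrix.trace, Matrix.diag_apply, Matrix.mul_apply, Matrix.transpose_apply]
  have key : ∀ α b, HasFDerivAt (fun y => (∑ a, v y a α * A y a b) * v y b α)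
      (0 : V →L[ℂ] ℂ) x := fun α b => by
    have h : DifferentiableAt ℂ (fun y => ∑ a, v y a α * A y a b) x :=
      DifferentiableAt.fun_sum fun a _ => (hv a α).fun_mul (hA a b)
    refine (h.hasFDerivAt.fun_mul (hv b α).hasFDerivAt).congr_fderiv ?_
    ext w
    simp [hx]
  simpa using HasFDerivAt.fun_sum (u := Finset.univ) fun α _ =>
    HasFDerivAt.fun_sum (u := Finset.univ) fun b _ => key α b

open Matrix in
/-- The sum of the propagators weighted by `y`, expanded as a quadratic polynomial in `k`. -/
theorem sum_mul_propagator_eq {n L E d : Type*} [Fintype n] [Fintype L] [Fintype E] [Fintype d]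
    [DecidableEq n] (R : Matrix n L ℂ) (S : Matrix n E ℂ) (m : n → ℂ)
    (k : Matrix L d ℂ) (p : Matrix E d ℂ) (y : n → ℂ) :
    ∑ i, y i * ((∑ α, ((R * k + S * p) i α) ^ 2) + m i ^ 2) =
      (kᵀ * (Rᵀ * diagonal y * R) * k).trace + 2 * (pᵀ * (Sᵀ * diagonal y * R) * k).trace
        + (pᵀ * (Sᵀ * diagonal y * S) * p).trace + ∑ i, y i * m i ^ 2 := by
  have hq : ∑ i, y i * ∑ α, ((R * k + S * p) i α) ^ 2 =
      ((R * k + S * p)ᵀ * diagonal y * (R * k + S * p)).trace := by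
    generalize R * k + S * p = Q
    simp only [trace, diag_apply, mul_apply (M := Qᵀ * diagonal y), mul_diagonal, transpose_apply]
    simp only [Finset.mul_sum]
    rw [Finset.sum_comm]
    exact Finset.sum_congr rfl fun i _ => Finset.sum_congr rfl fun α _ => by ring
  have hc : (kᵀ * Rᵀ * diagonal y * (S * p)).trace = (pᵀ * Sᵀ * diagonal y * (R * k)).trace := by
    rw [← trace_transpose]
    simp [Matrix.mul_assoc]
  simp only [mul_add, Finset.sum_add_distrib]
  rw [hq]
  simp only [transpose_add, transpose_mul, Matrix.add_mul, Matrix.mul_add, trace_add, hc]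
  simp only [Matrix.mul_assoc]
  ring

open Matrix in
theorem trace_quadratic_adjugate_eq {L E d : Type*} [Fintype L] [DecidableEq L]
    [Fintype E] [Fintype d] (M : Matrix L L ℂ) (hM : Mᵀ = M) (B : Matrix E L ℂ)
    (k : Matrix L d ℂ) (p : Matrix E d ℂ) :
    ((M * k + Bᵀ * p)ᵀ * M.adjugate * (M * k + Bᵀ * p)).trace =
      M.det * ((kᵀ * M * k).trace + 2 * (pᵀ * B * k).trace)
        + (pᵀ * B * M.adjugate * Bᵀ * p).trace := by
  have h₁ : (M * k + Bᵀ * p)ᵀ * M.adjugate * (M * k + Bᵀ * p) =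
      kᵀ * (M * M.adjugate) * (M * k) + kᵀ * (M * M.adjugate) * (Bᵀ * p)
        + (pᵀ * B * (M.adjugate * M) * k + pᵀ * B * M.adjugate * Bᵀ * p) := by
    simp only [transpose_add, transpose_mul, hM, transpose_transpose, Matrix.add_mul,
      Matrix.mul_add, Matrix.mul_assoc]
    abel
  have h₂ : (kᵀ * (Bᵀ * p)).trace = (pᵀ * B * k).trace := by
    rw [← trace_transpose]
    simp [Matrix.mul_assoc]
  rw [h₁, mul_adjugate, adjugate_mul]
  simp only [trace_add, Matrix.mul_smul, Matrix.smul_mul, trace_smul, Matrix.mul_one, h₂,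
    smul_eq_mul, ← Matrix.mul_assoc kᵀ M k]
  ring

open Matrix in
/-- Completing the square: the second Symanzik polynomial in terms of any loop momentum `k`. -/
theorem symanzik_eq {n L E d : Type*} [Fintype n] [Fintype L] [Fintype E] [Fintype d]
    [DecidableEq n] [DecidableEq L] (R : Matrix n L ℂ) (S : Matrix n E ℂ) (m : n → ℂ)
    (k : Matrix L d ℂ) (p : Matrix E d ℂ) (y : n → ℂ) :
    -(pᵀ * (Sᵀ * diagonal y * R) * (Rᵀ * diagonal y * R).adjugate
          * (Sᵀ * diagonal y * R)ᵀ * p).trace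
        + (Rᵀ * diagonal y * R).det
          * ((pᵀ * (Sᵀ * diagonal y * S) * p).trace + ∑ i, y i * m i ^ 2) =
      (Rᵀ * diagonal y * R).det
          * ∑ i, y i * ((∑ α, ((R * k + S * p) i α) ^ 2) + m i ^ 2)
        - (((Rᵀ * diagonal y * R) * k + (Sᵀ * diagonal y * R)ᵀ * p)ᵀ
            * (Rᵀ * diagonal y * R).adjugate
            * ((Rᵀ * diagonal y * R) * k + (Sᵀ * diagonal y * R)ᵀ * p)).trace := by
  rw [sum_mul_propagator_eq, trace_quadratic_adjugate_eq _ (by simp [Matrix.mul_assoc])]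
  ring

open Matrix in
/-- Parametric space Landau equations: for fixed `x` with `𝒰(x) = det M(x) ≠ 0`, the
momentum-space Landau equations (`∂Λ/∂k = 0` and `x i · D i(k) = 0` for all `i`) have a
solution `k` if and only if `ℱ(x) = 0` and `x i · (∂ℱ/∂x_i)(x) = 0` for all `i`. -/
theorem parametric_landau_equations (n L E d : ℕ)
    (hn : 0 < n) (hL : 0 < L) (hE : 0 < E) (hd : 0 < d)
    (R : Matrix (Fin n) (Fin L) ℂ) (S : Matrix (Fin n) (Fin E) ℂ)
    (m : Fin n → ℂ) (p : Matrix (Fin E) (Fin d) ℂ)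
    (M : (Fin n → ℂ) → Matrix (Fin L) (Fin L) ℂ)
    (hM : M = fun y => Rᵀ * Matrix.diagonal y * R)
    (B : (Fin n → ℂ) → Matrix (Fin E) (Fin L) ℂ)
    (hB : B = fun y => Sᵀ * Matrix.diagonal y * R)
    (C : (Fin n → ℂ) → Matrix (Fin E) (Fin E) ℂ)
    (hC : C = fun y => Sᵀ * Matrix.diagonal y * S)
    (F : (Fin n → ℂ) → ℂ)
    (hF : F = fun y => -(pᵀ * B y * (M y).adjugate * (B y)ᵀ * p).trace
      + (M y).det * ((pᵀ * C y * p).trace + ∑ i, y i * m i ^ 2))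
    (D : Matrix (Fin L) (Fin d) ℂ → Fin n → ℂ)
    (hD : D = fun k i => (∑ α, ((R * k + S * p) i α) ^ 2) + m i ^ 2)
    (x : Fin n → ℂ) (hU : (M x).det ≠ 0) :
    (∃ k, M x * k + (B x)ᵀ * p = 0 ∧ ∀ i, x i * D k i = 0) ↔
      (F x = 0 ∧ ∀ i, x i * fderiv ℂ F x (Pi.single i 1) = 0) := by
  subst hM hB hC hF hD
  dsimp only at hU ⊢
  have hlin : ∀ {K N : ℕ} (P : Matrix (Fin n) (Fin K) ℂ) (Q : Matrix (Fin n) (Fin N) ℂ) (a b),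
      DifferentiableAt ℂ (fun y : Fin n → ℂ => (Pᵀ * diagonal y * Q) a b) x := fun P Q a b => by
    simp only [mul_apply (M := _ * diagonal _), mul_diagonal]
    fun_prop
  have hdet := Matrix.differentiableAt_det (hlin R R)
  have hadj := Matrix.differentiableAt_adjugate_apply (hlin R R)
  suffices key : ∀ k : Matrix (Fin L) (Fin d) ℂ,
      (Rᵀ * diagonal x * R) * k + (Sᵀ * diagonal x * R)ᵀ * p = 0 →
      ((∀ i, x i * ((∑ α, ((R * k + S * p) i α) ^ 2) + m i ^ 2) = 0) ↔ _) by
    constructor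
    · rintro ⟨k, hk, h⟩
      exact (key k hk).1 h
    · intro h
      have hk : (Rᵀ * diagonal x * R) * -((Rᵀ * diagonal x * R)⁻¹ * ((Sᵀ * diagonal x * R)ᵀ * p))
          + (Sᵀ * diagonal x * R)ᵀ * p = 0 := by
        rw [Matrix.mul_neg, mul_nonsing_inv_cancel_left _ _ hU.isUnit, neg_add_cancel]
      exact ⟨_, hk, (key _ hk).2 h⟩
  intro k hk
  have hv : ∀ a α, DifferentiableAt ℂ (fun y : Fin n → ℂ =>
      ((Rᵀ * diagonal y * R) * k + (Sᵀ * diagonal y * R)ᵀ * p) a α) x := fun a α => by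
    simp only [Matrix.add_apply, mul_apply (N := k), mul_apply (N := p), transpose_apply _ a]
    exact (DifferentiableAt.fun_sum fun b _ => (hlin R R a b).mul_const _).fun_add
      (DifferentiableAt.fun_sum fun b _ => (hlin S R b a).mul_const _)
  have hquad := Matrix.hasFDerivAt_trace_transpose_mul_mul_of_eq_zero hv hadj hk
  simp only [symanzik_eq R S m k p]
  set D : Fin n → ℂ := fun i => (∑ α, ((R * k + S * p) i α) ^ 2) + m i ^ 2
  have hsum : HasFDerivAt (fun y : Fin n → ℂ => ∑ i, y i * D i)
      (∑ i, D i • ContinuousLinearMap.proj (R := ℂ) (φ := fun _ : Fin n => ℂ) i) x :=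
    HasFDerivAt.fun_sum fun i _ => (hasFDerivAt_apply i x).mul_const (D i)
  rw [((hdet.hasFDerivAt.fun_mul hsum).fun_sub hquad).fderiv, hk]
  have hpartial : ∀ j, (∑ i, D i • ContinuousLinearMap.proj (R := ℂ)
      (φ := fun _ : Fin n => ℂ) i) (Pi.single j 1) = D j := fun j => by
    simp [Pi.single_apply]
  simp only [_root_.add_apply, _root_.smul_apply, hpartial, Matrix.mul_zero, trace_zero,
    sub_zero, smul_eq_mul]
  constructor
  · intro h
    have h0 : ∑ i, x i * D i = 0 := Finset.sum_eq_zero fun i _ => h i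
    refine ⟨by rw [h0, mul_zero], fun i => ?_⟩
    rw [h0, zero_mul, add_zero, mul_left_comm, h i, mul_zero]
  · rintro ⟨h0, h⟩ i
    have hi := h i
    rw [(mul_eq_zero.1 h0).resolve_left hU, zero_mul, add_zero, mul_left_comm] at hi
    exact (mul_eq_zero.1 hi).resolve_left hU
end

section
/- Fix n ≥ 2 and a nonempty subset S ⊆ {1,…,n}, and let f_S = ∑_{i∈S} ∏_{j≠i} x_j ∈ ℂ[x_1,…,x_n]. (For S = {1,…,n} this is the first Symanzik polynomial 𝒰 of the (n−1)-loop banana graph, and for proper S the f_S are exactly the truncations of 𝒰 to the faces of its Newton polytope.) Then there is no x ∈ (ℂ*)^n with f_S(x) = 0 and (∂f_S/∂x_i)(x) = 0 for all i = 1,…,n. This expresses that the principal A-determinant of the first Symanzik polynomial of every banana graph equals 1. -/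
open MvPolynomial in
/-- The Euler operator `X k * ∂ₖ` acts on a squarefree monomial as multiplication by the exponent
of `X k`. -/
theorem X_mul_pderiv_prod_X {σ R : Type*} [CommSemiring R] [DecidableEq σ] (k : σ)
    (s : Finset σ) :
    X k * pderiv k (∏ j ∈ s, X j : MvPolynomial σ R) = if k ∈ s then ∏ j ∈ s, X j else 0 := by
  induction s using Finset.induction_on with
  | empty => simp
  | insert a s ha ih =>
    rw [Finset.prod_insert ha, Derivation.leibniz, smul_eq_mul, smul_eq_mul, mul_add,
      mul_left_comm, ih]
    obtain rfl | hka := eq_or_ne k a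
    · simp [ha, mul_comm]
    · simp [pderiv_X_of_ne hka.symm, hka]

open MvPolynomial in
theorem X_mul_pderiv_sum_prod_erase {σ R : Type*} [CommSemiring R] [Fintype σ] [DecidableEq σ]
    {S : Finset σ} {k : σ} (hk : k ∈ S) :
    X k * pderiv k (∑ i ∈ S, ∏ j ∈ Finset.univ.erase i, X j : MvPolynomial σ R) +
      ∏ j ∈ Finset.univ.erase k, X j = ∑ i ∈ S, ∏ j ∈ Finset.univ.erase i, X j := by
  rw [map_sum, Finset.mul_sum, ← Finset.sum_erase_add S _ hk, ← Finset.sum_erase_add S _ hk]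
  congr 1
  rw [X_mul_pderiv_prod_X, if_neg (Finset.notMem_erase k _), add_zero]
  refine Finset.sum_congr rfl fun i hi => ?_
  rw [X_mul_pderiv_prod_X,
    if_pos (Finset.mem_erase.2 ⟨(Finset.ne_of_mem_erase hi).symm, Finset.mem_univ k⟩)]

open MvPolynomial in
/-- For every nonempty `S ⊆ {1,…,n}` the polynomial `f_S = ∑_{i∈S} ∏_{j≠i} x j` (the first
Symanzik polynomial of the banana graph and its truncations) has no common zero with all its
partial derivatives in the algebraic torus: the principal `A`-determinant of the first
Symanzik polynomial of every banana graph equals `1`. -/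
theorem banana_U_principal_A_det (n : ℕ) (hn : 2 ≤ n) (S : Finset (Fin n)) (hS : S.Nonempty)
    (f : MvPolynomial (Fin n) ℂ)
    (hf : f = ∑ i ∈ S, ∏ j ∈ Finset.univ.erase i, X j) :
    ¬ ∃ x : Fin n → ℂ, (∀ i, x i ≠ 0) ∧ eval x f = 0 ∧
      ∀ i : Fin n, eval x (pderiv i f) = 0 := by
  rintro ⟨x, hx, hfx, hdf⟩
  obtain ⟨k, hk⟩ := hS
  have h := congrArg (eval x) (X_mul_pderiv_sum_prod_erase (R := ℂ) hk)
  rw [← hf, map_add, map_mul, hdf k, hfx, mul_zero, zero_add, map_prod] at h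
  exact Finset.prod_ne_zero_iff.2 (fun j _ => by simpa using hx j) h
end

section
/- (Second-type singularity of banana graphs.) Let n ≥ 2, 𝒰 = ∑_{i=1}^n ∏_{j≠i} x_j, ℱ_0 = s·x_1⋯x_n where s = p², and m ∈ ℂ^n. Suppose there exists y ∈ (ℂ*)^n with 𝒰(y) = 0 and ∑_{j=1}^n m_j² y_j ≠ 0. Then the second-type equations — 𝒰(x) = 0, ℱ_0(x) = 0, and ∂ℱ_0/∂x_i(x) + ∂𝒰/∂x_i(x)·(x_0 + ∑_j m_j² x_j) = 0 for i = 1,…,n — admit a solution (x_0,x) ∈ (ℂ*)^{n+1} if and only if p² = 0. Thus the second-type singularity of every L-loop banana graph is p² = 0. -/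
open MvPolynomial in
/-- Second-type singularity of banana graphs: with `𝒰 = ∑_i ∏_{j≠i} x j` and
`ℱ₀ = s·x 1⋯x n` (`s = p²`), and assuming a torus point `y` with `𝒰(y) = 0` and
`∑ m j² y j ≠ 0` exists, the second-type equations have a solution in the torus if and only if
`p² = 0`. -/
theorem second_type_singularity_banana (n : ℕ) (hn : 2 ≤ n) (s : ℂ) (m : Fin n → ℂ)
    (U : MvPolynomial (Fin n) ℂ) (hU : U = ∑ i, ∏ j ∈ Finset.univ.erase i, X j)
    (F0 : MvPolynomial (Fin n) ℂ) (hF0 : F0 = C s * ∏ j, X j)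
    (hy : ∃ y : Fin n → ℂ, (∀ i, y i ≠ 0) ∧ eval y U = 0 ∧ ∑ j, m j ^ 2 * y j ≠ 0) :
    (∃ (x0 : ℂ) (x : Fin n → ℂ), x0 ≠ 0 ∧ (∀ i, x i ≠ 0) ∧
        eval x U = 0 ∧ eval x F0 = 0 ∧
        ∀ i : Fin n,
          eval x (pderiv i F0) + eval x (pderiv i U) * (x0 + ∑ j, m j ^ 2 * x j) = 0) ↔
      s = 0 := by
  subst hF0
  constructor
  · rintro ⟨x0, x, -, hx, -, hF, -⟩
    have hprod : ∏ j, x j ≠ 0 := Finset.prod_ne_zero_iff.mpr fun j _ => hx j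
    simpa [eval_prod, hprod] using hF
  · rintro rfl
    obtain ⟨y, hy0, hyU, hym⟩ := hy
    exact ⟨-∑ j, m j ^ 2 * y j, y, neg_ne_zero.mpr hym, hy0, hyU, by simp, fun i => by simp⟩
end

section
/- (Second-type singularity of 1-loop graphs.) Let 𝒰 = x_1 + … + x_n, ℱ_0 = ∑_{1≤i<j≤n} s_{ij} x_i x_j with symmetric s_{ij} = s_{ji} ∈ ℂ and s_{ii} = 0, and m ∈ ℂ^n. If there exists (x_0,x) ∈ (ℂ*)^{n+1} satisfying the second-type equations 𝒰(x) = 0, ℱ_0(x) = 0, and ∂ℱ_0/∂x_i(x) + (x_0 + ∑_j m_j² x_j) = 0 for all i = 1,…,n (note ∂𝒰/∂x_i = 1), then the determinant of the n×n matrix whose first row is (1,1,…,1) and whose (i+1)-th row, for i = 1,…,n−1, is (s_{ij} − s_{nj})_{j=1,…,n}, vanishes. In particular, the second-type singularity of a massive 1-loop graph does not depend on the masses. -/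
open MvPolynomial in
/-- The partial derivatives of the quadratic form `∑_{i<j} s i j · x i · x j` attached to a
symmetric matrix `s` with zero diagonal. -/
theorem eval_pderiv_sum_lt {R ι : Type*} [CommRing R] [Fintype ι] [LinearOrder ι]
    (s : ι → ι → R) (hsym : ∀ i j, s i j = s j i) (hdiag : ∀ i, s i i = 0) (x : ι → R) (k : ι) :
    eval x (pderiv k (∑ i, ∑ j ∈ Finset.univ.filter (fun j => i < j),
      C (s i j) * X i * X j)) = ∑ j, s k j * x j := by
  have hterm (i j : ι) : eval x (pderiv k (C (s i j) * X i * X j)) =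
      (if i = k then s i j * x j else 0) + (if j = k then s i j * x i else 0) := by
    simp only [Derivation.leibniz, pderiv_X, pderiv_C, smul_eq_mul, Pi.single_apply,
      map_add, map_mul, eval_C, eval_X, mul_zero, add_zero]
    split_ifs <;> simp <;> ring
  simp only [map_sum, hterm]
  simp only [Finset.sum_filter]
  have hsplit (i j : ι) : (if i < j then (if i = k then s i j * x j else 0) +
      (if j = k then s i j * x i else 0) else 0) =
      (if i = k then (if k < j then s k j * x j else 0) else 0) +
      (if j = k then (if i < k then s k i * x i else 0) else 0) := by
    by_cases hi : i = k <;> by_cases hj : j = k <;> simp [hi, hj, hsym i k]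
  simp only [hsplit, Finset.sum_add_distrib]
  rw [Finset.sum_comm]
  simp only [Finset.sum_ite_eq', Finset.mem_univ, if_true]
  rw [← Finset.sum_add_distrib]
  refine Finset.sum_congr rfl fun j _ => ?_
  rcases lt_trichotomy j k with h | rfl | h
  · simp [h, h.not_gt]
  · simp [hdiag]
  · simp [h, h.not_gt]


open MvPolynomial in
/-- Second-type singularity of 1-loop graphs: if the second-type equations for
`𝒰 = x 1 + … + x n`, `ℱ₀ = ∑_{i<j} s i j · x i · x j` have a solution `(x0, x)` in the torus,
then the determinant of the matrix with first row `(1,…,1)` and remaining rows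
`(s i j - s n j)_j` vanishes.  (Here the `n = n'+1` edges are indexed by `Fin (n'+1)`, the
"last" edge playing the role of edge `n`.)  In particular the second-type singularity of a
massive 1-loop graph does not depend on the masses. -/
theorem second_type_singularity_one_loop (n' : ℕ)
    (s : Fin (n' + 1) → Fin (n' + 1) → ℂ)
    (hsym : ∀ i j, s i j = s j i) (hdiag : ∀ i, s i i = 0)
    (m : Fin (n' + 1) → ℂ)
    (U F0 : MvPolynomial (Fin (n' + 1)) ℂ)
    (hU : U = ∑ i, X i)
    (hF0 : F0 = ∑ i, ∑ j ∈ Finset.univ.filter (fun j => i < j), C (s i j) * X i * X j)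
    (x0 : ℂ) (x : Fin (n' + 1) → ℂ) (hx0 : x0 ≠ 0) (hx : ∀ i, x i ≠ 0)
    (h1 : eval x U = 0) (h2 : eval x F0 = 0)
    (h3 : ∀ i, eval x (pderiv i F0) + (x0 + ∑ j, m j ^ 2 * x j) = 0) :
    (Matrix.of (Fin.cons (fun _ => (1 : ℂ))
      (fun i j => s i.castSucc j - s (Fin.last n') j))).det = 0 := by
  subst hU hF0
  simp only [eval_pderiv_sum_lt s hsym hdiag] at h3
  refine Matrix.exists_mulVec_eq_zero_iff.mp
    ⟨x, fun h => hx 0 (congrFun h 0), funext fun i => ?_⟩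
  refine Fin.cases ?_ (fun i => ?_) i
  · simpa [Matrix.mulVec, dotProduct] using h1
  · simp only [Matrix.mulVec, dotProduct, Matrix.of_apply, Fin.cons_succ, sub_mul,
      Finset.sum_sub_distrib, Pi.zero_apply]
    linear_combination h3 i.castSucc - h3 (Fin.last n')
end

section
/- Let m_2, m_3 ∈ ℂ and p_1² ∈ ℂ, and let r_1 = x_2 + x_3 + m_2² x_2² + m_3² x_3² + (p_1² + m_2² + m_3²) x_2 x_3 ∈ ℂ[x_2,x_3] (the truncation of the Lee–Pomeransky polynomial 𝒰 + ℱ of the one-loop triangle graph to a proper mixed face of its Newton polytope; it is the Lee–Pomeransky polynomial of the one-loop bubble). If there exists (x_2,x_3) ∈ (ℂ*)² with r_1 = ∂r_1/∂x_2 = ∂r_1/∂x_3 = 0, then p_1² = 0. Hence the contribution of this mixed face to the singular locus of the triangle graph is p_1² = 0. -/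
open MvPolynomial in
/-- The truncation `r₁` of the Lee–Pomeransky polynomial of the triangle graph to a proper
mixed face (the Lee–Pomeransky polynomial of the one-loop bubble): if `r₁` and its two partial
derivatives have a common zero in the torus `(ℂ*)²`, then `p₁² = 0`. -/
theorem triangle_mixed_face_contribution (m2 m3 P : ℂ)
    (r1 : MvPolynomial (Fin 2) ℂ)
    (hr1 : r1 = X 0 + X 1 + C (m2 ^ 2) * X 0 ^ 2 + C (m3 ^ 2) * X 1 ^ 2
      + C (P + m2 ^ 2 + m3 ^ 2) * X 0 * X 1)
    (h : ∃ x : Fin 2 → ℂ, (∀ i, x i ≠ 0) ∧ eval x r1 = 0 ∧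
      ∀ i : Fin 2, eval x (pderiv i r1) = 0) :
    P = 0 := by
  obtain ⟨x, hx, hr, hd⟩ := h
  have hd0 := hd 0
  have hd1 := hd 1
  subst hr1
  simp [pderiv_X] at hr hd0 hd1
  have hlin : x 0 + x 1 = 0 := by
    linear_combination 2 * hr - x 0 * hd0 - x 1 * hd1
  have hx1 : x 1 = -x 0 := by linear_combination hlin
  rw [hx1] at hr
  have hP : P * x 0 ^ 2 = 0 := by linear_combination -hr
  exact (mul_eq_zero.mp hP).resolve_right (pow_ne_zero 2 (hx 0))
end
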